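/- Let a, u be coprime positive integers with a ≠ u and Δ = u² − a². If an integer X satisfies (X² − 8Δ²)(X² − 9Δ²) = 4a²u²X², then gcd(X, Δ) = 1. -/

import Mathlib

def SolQ (p q : ℤ) : Prop :=
  p ≠ 0 ∧ q ≠ 0 ∧ IsCoprime p q ∧ (∃ A : ℤ, p ^ 2 + q ^ 2 = A ^ 2) ∧ ∃ C : ℤ, p ^ 2 + 9 * q ^ 2 = C ^ 2

lemma three_dvd_of_sq {b : ℤ} {c : ℤ} (h : b ^ 2 = 3 * c) : (3 : ℤ) ∣ b :=
  Int.prime_three.dvd_of_dvd_pow ⟨c, h⟩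

lemma SolQ.swap {p q : ℤ} (h : SolQ p q) (hp : Even p) :
    ∃ p' q', SolQ p' q' ∧ Even q' ∧ q'.natAbs ≤ p.natAbs := by
  obtain ⟨hp0, hq0, hco, ⟨A, hA⟩, C, hC⟩ := h
  by_cases h3 : (3 : ℤ) ∣ p
  · obtain ⟨b, rfl⟩ := h3
    obtain ⟨c, rfl⟩ : (3 : ℤ) ∣ C := three_dvd_of_sq (c := 3 * b ^ 2 + 3 * q ^ 2) (by rw [← hC]; ring)
    refine ⟨q, b, ⟨hq0, by rintro rfl; simp at hp0, ?_, ⟨c, by linarith⟩, A, by linarith⟩, ?_, ?_⟩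
    · exact (IsCoprime.of_mul_left_right hco).symm
    · rcases Int.even_mul.mp hp with h | h
      · exact absurd h (by decide)
      · exact h
    · omega
  · refine ⟨3 * q, p, ⟨by simpa using hq0, hp0, ?_, ⟨C, by linarith⟩, 3 * A, by linarith⟩, hp, le_rfl⟩
    have h3' : IsCoprime (3 : ℤ) p := (Int.prime_three.coprime_iff_not_dvd).2 h3
    exact IsCoprime.mul_left h3' hco.symm

lemma SolQ.norm {p q : ℤ} (h : SolQ p q) :
    ∃ p' q', SolQ p' q' ∧ Even q' ∧ q'.natAbs ≤ max p.natAbs q.natAbs := by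
  rcases Int.even_or_odd q with hq | hq
  · exact ⟨p, q, h, hq, le_max_right _ _⟩
  rcases Int.even_or_odd p with hp | hp
  · obtain ⟨p', q', h1, h2, h3⟩ := h.swap hp
    exact ⟨p', q', h1, h2, h3.trans (le_max_left _ _)⟩
  exfalso
  obtain ⟨_, _, _, ⟨A, hA⟩, _⟩ := h
  have h1 := Int.sq_mod_four_eq_one_of_odd hp
  have h2 := Int.sq_mod_four_eq_one_of_odd hq
  rcases Int.even_or_odd A with ⟨k, rfl⟩ | hA'
  · have : (k + k) ^ 2 = 4 * k ^ 2 := by ring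
    omega
  · have h3 := Int.sq_mod_four_eq_one_of_odd hA'
    omega

lemma core {α β γ ε : ℤ} (hα : α ≠ 0) (hβ : β ≠ 0) (hγ : γ ≠ 0)
    (hβγ : IsCoprime β γ) (hαε : IsCoprime α ε) (hαγ : IsCoprime α γ) (hβo : Odd β)
    (h : β ^ 2 * (ε ^ 2 - α ^ 2) = γ ^ 2 * (ε ^ 2 + 8 * α ^ 2)) : SolQ γ α ∨ SolQ α γ := by
  have hd : γ ^ 2 ∣ ε ^ 2 - α ^ 2 :=
    (hβγ.symm.pow (m := 2) (n := 2)).dvd_of_dvd_mul_left ⟨_, h⟩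
  obtain ⟨k, hk⟩ := hd
  have hk2 : ε ^ 2 + 8 * α ^ 2 = k * β ^ 2 := by
    have : γ ^ 2 ≠ 0 := pow_ne_zero _ hγ
    apply mul_left_cancel₀ this
    rw [← h, hk]; ring
  have hk0 : 0 < k := by
    have h1 : 0 < α ^ 2 := by positivity
    have h2 : 0 < β ^ 2 := by positivity
    have : 0 < k * β ^ 2 := by rw [← hk2]; positivity
    exact pos_of_mul_pos_left this h2.le
  have hk9 : k ∣ 9 := by
    obtain ⟨s, t, hst⟩ := hαε.pow (m := 2) (n := 2)
    refine ⟨s * (β ^ 2 - γ ^ 2) + t * (β ^ 2 + 8 * γ ^ 2), ?_⟩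
    linear_combination (-9) * hst + (8 * t - s) * hk + (s + t) * hk2
  have hkle : k ≤ 9 := Int.le_of_dvd (by norm_num) hk9
  have hcases : k = 1 ∨ k = 3 ∨ k = 9 := by
    interval_cases k <;> simp_all (config := { decide := true })
  rcases hcases with rfl | rfl | rfl
  · left
    exact ⟨hγ, hα, hαγ.symm, ⟨ε, by linarith⟩, β, by linarith⟩
  · exfalso
    have h1 := Int.sq_mod_four_eq_one_of_odd hβo
    rcases Int.even_or_odd ε with ⟨j, rfl⟩ | he
    · have : (j + j) ^ 2 = 4 * j ^ 2 := by ring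
      omega
    · have h3 := Int.sq_mod_four_eq_one_of_odd he
      omega
  · right
    exact ⟨hα, hγ, hαγ, ⟨β, by linarith⟩, ε, by linarith⟩

lemma step {p q : ℤ} (h : SolQ p q) (hq : Even q) :
    ∃ p' q', SolQ p' q' ∧ Even q' ∧ q'.natAbs < q.natAbs := by
  obtain ⟨hp0, hq0, hco, ⟨A', hA'⟩, C', hC'⟩ := h
  obtain ⟨A, hA0, hA⟩ : ∃ A : ℤ, 0 ≤ A ∧ p ^ 2 + q ^ 2 = A ^ 2 :=
    ⟨|A'|, abs_nonneg _, by rw [sq_abs, hA']⟩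
  obtain ⟨C, hC0, hC⟩ : ∃ C : ℤ, 0 ≤ C ∧ p ^ 2 + 9 * q ^ 2 = C ^ 2 :=
    ⟨|C'|, abs_nonneg _, by rw [sq_abs, hC']⟩
  have hpp : 0 < p ^ 2 := by positivity
  have hqq : 0 < q ^ 2 := by positivity
  have hA0' : 0 < A := by
    rcases hA0.eq_or_lt with h | h
    · subst h; nlinarith
    · exact h
  have hpo : p % 2 = 1 := by
    rcases Int.even_or_odd p with h | h
    · have := hco.isUnit_of_dvd' h.two_dvd hq.two_dvd
      exact absurd this (by decide)
    · exact Int.odd_iff.mp h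
  have hpt : PythagoreanTriple p q A := by
    unfold PythagoreanTriple; linarith
  obtain ⟨m, n, h1, h2, h3, hmn, hpar, -⟩ :=
    hpt.coprime_classification' (Int.isCoprime_iff_gcd_eq_one.mp hco) hpo hA0'
  have hmn' : IsCoprime m n := Int.isCoprime_iff_gcd_eq_one.mpr hmn
  have hA4 : A % 4 = 1 := by
    rcases hpar with ⟨hm, hn⟩ | ⟨hm, hn⟩
    · have e1 := Int.sq_mod_four_eq_one_of_odd (Int.odd_iff.mpr hn)
      obtain ⟨j, rfl⟩ : (2:ℤ) ∣ m := Int.dvd_of_emod_eq_zero hm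
      have : (2 * j) ^ 2 = 4 * j ^ 2 := by ring
      omega
    · have e1 := Int.sq_mod_four_eq_one_of_odd (Int.odd_iff.mpr hm)
      obtain ⟨j, rfl⟩ : (2:ℤ) ∣ n := Int.dvd_of_emod_eq_zero hn
      have : (2 * j) ^ 2 = 4 * j ^ 2 := by ring
      omega
  have hCo : C % 2 = 1 := by
    rcases Int.even_or_odd C with ⟨j, rfl⟩ | h
    · exfalso
      have e1 := Int.sq_mod_four_eq_one_of_odd (Int.odd_iff.mpr hpo)
      have : (j + j) ^ 2 = 4 * j ^ 2 := by ring
      obtain ⟨i, rfl⟩ := hq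
      have : (i + i) ^ 2 = 4 * i ^ 2 := by ring
      omega
    · exact Int.odd_iff.mp h
  obtain ⟨c1, hc1⟩ : (2 : ℤ) ∣ C - A := by omega
  obtain ⟨c2, rfl⟩ : ∃ c2, A = c2 - c1 := ⟨A + c1, by ring⟩
  obtain rfl : C = c1 + c2 := by linarith
  have hprod : c1 * c2 = 8 * (m * n) ^ 2 := by
    rw [h2] at hA hC; linarith
  have hm0 : m ≠ 0 := by rintro rfl; simp at h2; exact hq0 h2
  have hn0 : n ≠ 0 := by rintro rfl; simp at h2; exact hq0 h2
  have hmnpos : 0 < (m * n) ^ 2 := by positivity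
  have hc1p : 0 < c1 := by nlinarith
  have hc2p : 0 < c2 := by linarith
  -- coprimality of A and m n
  have hcoA : IsCoprime (c2 - c1) (m * n) := by
    rw [h3]
    refine IsCoprime.mul_right ?_ ?_
    · have : IsCoprime (n ^ 2) m := hmn'.symm.pow_left
      have := IsCoprime.add_mul_left_left this m
      rwa [show n ^ 2 + m * m = m ^ 2 + n ^ 2 by ring] at this
    · have : IsCoprime (m ^ 2) n := hmn'.pow_left
      have := IsCoprime.add_mul_left_left this n
      rwa [show m ^ 2 + n * n = m ^ 2 + n ^ 2 by ring] at this
  have hcoc : IsCoprime c1 c2 := by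
    have h8 : IsCoprime (c2 - c1) (8 * (m * n) ^ 2) := by
      refine IsCoprime.mul_right ?_ hcoA.pow_right
      have : IsCoprime (c2 - c1) 2 := by
        refine ⟨1, -((c2 - c1 - 1) / 2), ?_⟩
        omega
      have h := this.pow_right (n := 3)
      norm_num at h
      exact h
    rw [← hprod] at h8
    have h9 := h8.of_mul_right_left
    have := IsCoprime.add_mul_left_left h9 1
    rw [show c2 - c1 + c1 * 1 = c2 by ring] at this
    exact this.symm
  have key : ∀ x y : ℤ, 0 < x → 0 < y → IsCoprime x y → x * y = 8 * (m * n) ^ 2 → y % 2 = 1 →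
      ∃ r s : ℤ, x = 8 * r ^ 2 ∧ y = s ^ 2 ∧ (m * n) = r * s := by
    intro x y hx hy hxy he hyo
    have : IsCoprime (8 : ℤ) y := by
      have h : IsCoprime (2 : ℤ) y := ⟨-((y - 1) / 2), 1, by omega⟩
      have := h.pow_left (m := 3)
      norm_num at this
      exact this
    obtain ⟨k, rfl⟩ := this.dvd_of_dvd_mul_right ⟨_, he⟩
    have he' : k * y = (m * n) ^ 2 := by linarith
    have hk : IsCoprime k y := hxy.of_mul_left_right
    obtain ⟨r, hr⟩ := Int.sq_of_isCoprime hk he'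
    obtain ⟨s, hs⟩ := Int.sq_of_isCoprime hk.symm (by rw [mul_comm]; exact he')
    have hr' : k = r ^ 2 := by
      rcases hr with h | h
      · exact h
      · nlinarith [sq_nonneg r]
    have hs' : y = s ^ 2 := by
      rcases hs with h | h
      · exact h
      · nlinarith [sq_nonneg s]
    have : (m * n) ^ 2 = (r * s) ^ 2 := by rw [← he', hr', hs']; ring
    rcases sq_eq_sq_iff_eq_or_eq_neg.mp this with h | h
    · exact ⟨r, s, by rw [hr'], hs', h⟩
    · exact ⟨-r, s, by rw [hr']; ring, hs', by rw [h]; ring⟩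
  have hsol : ∃ r s : ℤ, c1 = 8 * r ^ 2 ∧ c2 = s ^ 2 ∧ m * n = r * s := by
    rcases Int.emod_two_eq_zero_or_one c2 with h | h
    · exfalso
      obtain ⟨r, s, e1, e2, _⟩ := key c2 c1 hc2p hc1p hcoc.symm (by rw [mul_comm]; exact hprod) (by omega)
      have hs : Odd s := by
        have : Odd (s ^ 2) := by rw [← e2]; exact Int.odd_iff.mpr (by omega)
        exact (Int.odd_pow.mp this).resolve_right (by norm_num)
      have := Int.sq_mod_four_eq_one_of_odd hs
      omega
    · exact key c1 c2 hc1p hc2p hcoc hprod h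
  obtain ⟨r, s, e1, e2, e3⟩ := hsol
  have hso : Odd s := by
    have : Odd (s ^ 2) := by rw [← e2]; exact Int.odd_iff.mpr (by omega)
    exact (Int.odd_pow.mp this).resolve_right (by norm_num)
  have hrs : IsCoprime r s := by
    rw [e1, e2] at hcoc
    have := hcoc.of_mul_left_right
    exact (IsCoprime.pow_iff (by norm_num) (by norm_num)).mp this
  obtain ⟨α, β, ⟨γ, rfl⟩, ⟨ε, rfl⟩, rfl⟩ := exists_dvd_and_dvd_of_dvd_mul (show m ∣ r * s from ⟨n, e3.symm⟩)
  have hα : α ≠ 0 := left_ne_zero_of_mul hm0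
  have hβ : β ≠ 0 := right_ne_zero_of_mul hm0
  obtain rfl : n = γ * ε := by
    apply mul_left_cancel₀ hm0; rw [e3]; ring
  have hγ : γ ≠ 0 := left_ne_zero_of_mul hn0
  have hε : ε ≠ 0 := right_ne_zero_of_mul hn0
  have hc := core (α := α) (β := β) (γ := γ) (ε := ε) hα hβ hγ
    hmn'.of_mul_left_right.of_mul_right_left hrs.of_mul_left_left.of_mul_right_right
    hmn'.of_mul_left_left.of_mul_right_left (Int.odd_mul.mp hso).1
    (by rw [e1, e2] at h3; linear_combination h3)
  have hbound : max α.natAbs γ.natAbs < q.natAbs := by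
    rw [h2]
    simp only [Int.natAbs_mul]
    have a1 := Int.natAbs_pos.mpr hα
    have a2 := Int.natAbs_pos.mpr hβ
    have a3 := Int.natAbs_pos.mpr hγ
    have a4 := Int.natAbs_pos.mpr hε
    have b1 : 1 ≤ β.natAbs * ε.natAbs := Nat.mul_pos a2 a4
    have b2 : α.natAbs * γ.natAbs ≤ (α.natAbs * γ.natAbs) * (β.natAbs * ε.natAbs) :=
      Nat.le_mul_of_pos_right _ b1
    have b3 : Int.natAbs 2 * (α.natAbs * β.natAbs) * (γ.natAbs * ε.natAbs)
      = 2 * ((α.natAbs * γ.natAbs) * (β.natAbs * ε.natAbs)) := by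
      rw [show Int.natAbs 2 = 2 from rfl]; ring
    rw [b3]
    have b4 : α.natAbs ≤ α.natAbs * γ.natAbs := Nat.le_mul_of_pos_right _ a3
    have b5 : γ.natAbs ≤ α.natAbs * γ.natAbs := Nat.le_mul_of_pos_left _ a1
    omega
  rcases hc with hc | hc
  · obtain ⟨p', q', g1, g2, g3⟩ := hc.norm
    exact ⟨p', q', g1, g2, lt_of_le_of_lt g3 (by rwa [max_comm])⟩
  · obtain ⟨p', q', g1, g2, g3⟩ := hc.norm
    exact ⟨p', q', g1, g2, lt_of_le_of_lt g3 hbound⟩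

lemma no_even (N : ℕ) : ∀ p q : ℤ, q.natAbs = N → Even q → ¬ SolQ p q := by
  induction N using Nat.strong_induction_on with
  | _ N ih =>
    intro p q hN hq h
    obtain ⟨p', q', h1, h2, h3⟩ := step h hq
    exact ih _ (hN ▸ h3) p' q' rfl h2 h1

lemma no_sol (p q : ℤ) : ¬ SolQ p q := by
  intro h
  obtain ⟨p', q', h1, h2, _⟩ := h.norm
  exact no_even _ p' q' rfl h2 h1

theorem star_solution_coprime_delta (a u : ℤ) (ha : 0 < a) (hu : 0 < u)
    (hco : IsCoprime a u) (hne : a ≠ u) (X : ℤ)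
    (hstar : (X ^ 2 - 8 * (u ^ 2 - a ^ 2) ^ 2) * (X ^ 2 - 9 * (u ^ 2 - a ^ 2) ^ 2) =
      4 * a ^ 2 * u ^ 2 * X ^ 2) :
    Int.gcd X (u ^ 2 - a ^ 2) = 1 := by
  exfalso
  have hD : u ^ 2 - a ^ 2 ≠ 0 := by
    intro h
    have : (u - a) * (u + a) = 0 := by linarith
    rcases mul_eq_zero.mp this with h | h
    · exact hne (by linarith)
    · linarith
  generalize u ^ 2 - a ^ 2 = D at *
  have hX : X ≠ 0 := by
    rintro rfl
    have : 0 < D ^ 4 := by positivity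
    nlinarith
  have hgp : 0 < Int.gcd X D := Int.gcd_pos_of_ne_zero_left _ hX
  obtain ⟨g, x, d, hg, hxd, rfl, rfl⟩ : ∃ g x d : ℤ, g ≠ 0 ∧ IsCoprime x d ∧ X = g * x ∧ D = g * d := by
    obtain ⟨x, d, h1, h2, h3⟩ := Int.exists_gcd_one hgp
    exact ⟨Int.gcd X D, x, d, by exact_mod_cast hgp.ne', Int.isCoprime_iff_gcd_eq_one.mpr h1,
      by rw [mul_comm]; exact h2, by rw [mul_comm]; exact h3⟩
  have hx : x ≠ 0 := right_ne_zero_of_mul hX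
  have hd : d ≠ 0 := right_ne_zero_of_mul hD
  have h1 : g ^ 2 * ((x ^ 2 - 8 * d ^ 2) * (x ^ 2 - 9 * d ^ 2)) = (2 * a * u * x) ^ 2 := by
    apply mul_left_cancel₀ (pow_ne_zero 2 hg)
    linear_combination hstar
  obtain ⟨w, hw⟩ : g ∣ 2 * a * u * x := (Int.pow_dvd_pow_iff (by norm_num)).mp ⟨_, h1.symm⟩
  have hw0 : w ≠ 0 := by
    rintro rfl
    have : 2 * a * u * x ≠ 0 := by positivity
    simp at hw; omega
  have h2 : (x ^ 2 - 8 * d ^ 2) * (x ^ 2 - 9 * d ^ 2) = w ^ 2 := by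
    apply mul_left_cancel₀ (pow_ne_zero 2 hg)
    rw [h1, hw]; ring
  have hc : IsCoprime (x ^ 2 - 8 * d ^ 2) (x ^ 2 - 9 * d ^ 2) := by
    obtain ⟨s, t, hst⟩ := hxd.pow (m := 2) (n := 2)
    exact ⟨9 * s + t, -8 * s - t, by linear_combination hst⟩
  obtain ⟨A, hA⟩ := Int.sq_of_isCoprime hc h2
  obtain ⟨B, hB⟩ := Int.sq_of_isCoprime hc.symm (by rw [mul_comm]; exact h2)
  have hwp : 0 < w ^ 2 := by positivity
  have hdp : 0 < d ^ 2 := by positivity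
  have hB0 : B ≠ 0 := by
    rintro rfl
    have : x ^ 2 - 9 * d ^ 2 = 0 := by rcases hB with h | h <;> simpa using h
    rw [this, mul_zero] at h2; linarith
  have hBp : 0 < B ^ 2 := by positivity
  rcases hA with hA | hA
  · rcases hB with hB | hB
    · refine no_sol B d ⟨hB0, hd, ?_, ⟨A, by linarith⟩, x, by linarith⟩
      have : IsCoprime (B ^ 2) d := by
        rw [← hB]
        have : IsCoprime (x ^ 2) d := hxd.pow_left
        have := IsCoprime.add_mul_left_left this (-9 * d)
        rwa [show x ^ 2 + d * (-9 * d) = x ^ 2 - 9 * d ^ 2 by ring] at this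
      exact (IsCoprime.pow_left_iff (by norm_num)).mp this
    · rw [hA, hB] at h2
      nlinarith [mul_nonneg (sq_nonneg A) (sq_nonneg B)]
  · have hB' : x ^ 2 + B ^ 2 = 9 * d ^ 2 := by
      rcases hB with hB | hB
      · rw [hA, hB] at h2
        nlinarith [mul_nonneg (sq_nonneg A) (sq_nonneg B)]
      · linarith
    have m3 : ∀ z : ℤ, z ^ 2 % 3 = 0 ∧ 3 ∣ z ∨ z ^ 2 % 3 = 1 := by
      intro z
      have : z % 3 = 0 ∨ z % 3 = 1 ∨ z % 3 = 2 := by omega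
      rcases this with h | h | h
      · left; exact ⟨by simp [pow_two, Int.mul_emod, h], Int.dvd_of_emod_eq_zero h⟩
      · right; simp [pow_two, Int.mul_emod, h]
      · right; simp [pow_two, Int.mul_emod, h]
    have hx3 : (3 : ℤ) ∣ x ∧ (3 : ℤ) ∣ d := by
      have a1 := m3 x
      have a2 := m3 d
      have a3 := m3 A
      have a4 := m3 B
      omega
    have := hxd.isUnit_of_dvd' hx3.1 hx3.2
    exact absurd this (by decide)
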